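/- arXiv:2003.02246 — 3 statements merged into one kernel-verified Lean document; each statement's English description precedes it below -/
import Mathlib

section
/- Let q = 2^n with n ≥ 5 and let c ∈ F_q with Tr_{q/2}(c) = 1, where Tr_{q/2} is the trace from F_q to F_2. Define f: F_q → F_q by f(x) = x^2 + 1/(x^2 + x + c). Then for every integer k with 1 ≤ k ≤ 10, the sum over all x ∈ F_q of f(x)^k equals 0, while the sum over all x ∈ F_q of f(x)^{11} equals 1. -/
open Finset

section PowerSums

variable {F : Type*} [Field F] [Fintype F]

/-- The absolute trace of a field with `2 ^ n` elements, as an additive map `F → F`. -/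
def absTrace (F : Type*) [Field F] [CharP F 2] (n : ℕ) : F →+ F where
  toFun z := ∑ i ∈ range n, z ^ 2 ^ i
  map_zero' := by simp
  map_add' x y := by
    simp only [add_pow_char_pow, sum_add_distrib]

/-- The Artin–Schreier map `x ↦ x ^ 2 + x` in characteristic two. -/
def artinSchreier (F : Type*) [Field F] [CharP F 2] : F →+ F where
  toFun x := x ^ 2 + x
  map_zero' := by simp
  map_add' x y := by
    rw [CharTwo.add_sq]; ring

theorem charP_two_of_card {n : ℕ} (hF : Fintype.card F = 2 ^ n) : CharP F 2 := by
  have h : ((2 : F)) ^ n = 0 := by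
    have := FiniteField.cast_card_eq_zero F
    rw [hF] at this
    exact_mod_cast this
  exact CharTwo.of_one_ne_zero_of_two_eq_zero one_ne_zero (eq_zero_of_pow_eq_zero h)

theorem absTrace_artinSchreier [CharP F 2] {n : ℕ} (hF : Fintype.card F = 2 ^ n) (x : F) :
    absTrace F n (artinSchreier F x) = 0 := by
  have h : absTrace F n (artinSchreier F x) = ∑ i ∈ range n, (x ^ 2 ^ (i + 1) - x ^ 2 ^ i) := by
    change ∑ i ∈ range n, (x ^ 2 + x) ^ 2 ^ i = _
    refine sum_congr rfl fun i _ => ?_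
    rw [add_pow_char_pow, CharTwo.sub_eq_add, ← pow_mul, pow_succ']
  rw [h, sum_range_sub (fun i => x ^ 2 ^ i), ← hF, FiniteField.pow_card]
  simp

theorem artinSchreier_eq_iff {F : Type*} [Field F] [CharP F 2] (x y : F) :
    artinSchreier F x = artinSchreier F y ↔ x = y ∨ x = y + 1 := by
  have h2 : (2 : F) = 0 := CharTwo.two_eq_zero
  change x ^ 2 + x = y ^ 2 + y ↔ _
  constructor
  · intro h
    have : (x - y) * (x - (y + 1)) = 0 := by
      linear_combination h + (y ^ 2 + y - x * y - x) * h2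
    rcases mul_eq_zero.1 this with h | h
    · exact Or.inl (sub_eq_zero.1 h)
    · exact Or.inr (sub_eq_zero.1 h)
  · rintro (rfl | rfl)
    · rfl
    · linear_combination (y + 1) * h2

theorem index_range_artinSchreier [CharP F 2] : (artinSchreier F).range.index = 2 := by
  have hk : Nat.card (artinSchreier F).ker = 2 := by
    have : ((artinSchreier F).ker : Set F) = {0, 1} := by
      ext x
      have := artinSchreier_eq_iff x 0
      simpa using this
    change Nat.card ((artinSchreier F).ker : Set F) = 2
    rw [this, Nat.card_coe_set_eq, Set.ncard_pair zero_ne_one]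
  have h1 := (artinSchreier F).ker.card_mul_index
  have h2 := (artinSchreier F).range.card_mul_index
  rw [AddSubgroup.index_ker, hk] at h1
  have : 0 < Nat.card (artinSchreier F).range := Nat.card_pos
  nlinarith

theorem mem_range_artinSchreier_or_absTrace_eq_one [CharP F 2] {n : ℕ}
    (hF : Fintype.card F = 2 ^ n) {c : F} (hc : absTrace F n c = 1) (y : F) :
    y ∈ (artinSchreier F).range ∨ absTrace F n y = 1 := by
  by_cases hy : y ∈ (artinSchreier F).range
  · exact Or.inl hy
  right
  have hcn : c ∉ (artinSchreier F).range := by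
    rintro ⟨x, rfl⟩
    rw [absTrace_artinSchreier hF] at hc
    exact zero_ne_one hc
  have hyc : y + c ∈ (artinSchreier F).range := by
    rw [AddSubgroup.add_mem_iff_of_index_two index_range_artinSchreier]
    simp [hy, hcn]
  obtain ⟨x, hx⟩ := hyc
  have := absTrace_artinSchreier hF x
  rw [hx, map_add, hc] at this
  exact CharTwo.add_eq_zero.1 this

theorem sum_fiber_artinSchreier [CharP F 2] [DecidableEq F] {n : ℕ}
    (hF : Fintype.card F = 2 ^ n) {c : F} (hc : absTrace F n c = 1) (y : F) :
    ∑ x with artinSchreier F x = y, x = absTrace F n (y + c) := by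
  rw [map_add, hc]
  by_cases hy : y ∈ (artinSchreier F).range
  · obtain ⟨x, rfl⟩ := hy
    have : ({z | artinSchreier F z = artinSchreier F x} : Finset F) = {x, x + 1} := by
      ext z
      simp [artinSchreier_eq_iff]
    rw [this, absTrace_artinSchreier hF, sum_pair (by simp), ← add_assoc,
      CharTwo.add_self_eq_zero]
  · rw [(mem_range_artinSchreier_or_absTrace_eq_one hF hc y).resolve_left hy,
      CharTwo.add_self_eq_zero, filter_false_of_mem, sum_empty]
    exact fun x _ hx => hy ⟨x, hx⟩

theorem sum_mul_comp_artinSchreier [CharP F 2] {n : ℕ}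
    (hF : Fintype.card F = 2 ^ n) {c : F} (hc : absTrace F n c = 1) (g : F → F) :
    ∑ x, x * g (x ^ 2 + x + c) = ∑ z, absTrace F n z * g z := by
  classical
  rw [← sum_fiberwise (s := univ) (g := artinSchreier F)]
  rw [← Equiv.sum_comp (Equiv.addRight c) (fun z => absTrace F n z * g z)]
  refine sum_congr rfl fun y _ => ?_
  rw [Equiv.coe_addRight, ← sum_fiber_artinSchreier hF hc, sum_mul]
  refine sum_congr rfl fun x hx => ?_
  rw [← (mem_filter.1 hx).2]
  rfl

theorem sum_pow_mul_inv_pow [CharP F 2] {a b : ℕ} (ha : 0 < a) (hb : 0 < b)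
    (ha' : a < Fintype.card F - 1) (hb' : b < Fintype.card F - 1) :
    ∑ z : F, z ^ a * z⁻¹ ^ b = if a = b then 1 else 0 := by
  classical
  have key : ∀ a b : ℕ, 0 < b → b < a → a < Fintype.card F - 1 →
      ∑ z : F, z ^ a * z⁻¹ ^ b = 0 := by
    intro a b hb hba ha
    rw [← FiniteField.sum_pow_lt_card_sub_one F (a - b) (by omega)]
    refine sum_congr rfl fun z _ => ?_
    rcases eq_or_ne z 0 with rfl | hz
    · rw [zero_pow (by omega), zero_pow (by omega), zero_mul]
    · rw [pow_sub₀ _ hz hba.le, inv_pow]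
  rcases lt_trichotomy a b with h | rfl | h
  · rw [if_neg h.ne, ← key b a ha h hb', ← Equiv.sum_comp (Equiv.inv F)]
    refine sum_congr rfl fun z _ => ?_
    simp [mul_comm]
  · have : ∀ z : F, z ^ a * z⁻¹ ^ a = 1 - if z = 0 then 1 else 0 := by
      intro z
      split_ifs with hz
      · simp [hz, ha.ne']
      · rw [← mul_pow, mul_inv_cancel₀ hz, one_pow, sub_zero]
    simp_rw [this]
    simp [CharTwo.neg_eq]
  · rw [if_neg h.ne', key a b hb h ha']

/-- The sums of `x / (x ^ 2 + x + c) ^ b` count the powers of two equal to `b`. -/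
theorem sum_mul_inv_pow [CharP F 2] {n : ℕ} (hn : 5 ≤ n)
    (hF : Fintype.card F = 2 ^ n) {c : F} (hc : absTrace F n c = 1) {b : ℕ} (hb : 0 < b)
    (hb' : b < 16) :
    ∑ x : F, x * (x ^ 2 + x + c)⁻¹ ^ b =
      if b = 1 ∨ b = 2 ∨ b = 4 ∨ b = 8 then 1 else 0 := by
  rw [sum_mul_comp_artinSchreier hF hc (fun z => z⁻¹ ^ b)]
  obtain ⟨m, rfl⟩ := Nat.exists_eq_add_of_le hn
  have hm : 1 ≤ 2 ^ m := Nat.one_le_two_pow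
  have hcard : Fintype.card F = 32 * 2 ^ m := by rw [hF, pow_add]; norm_num
  have h : ∀ i ∈ range (5 + m), ∑ z : F, z ^ 2 ^ i * z⁻¹ ^ b = if 2 ^ i = b then 1 else 0 := by
    intro i hi
    refine sum_pow_mul_inv_pow (by positivity) hb ?_ (by omega)
    have : 2 ^ i ≤ 2 ^ (4 + m) := Nat.pow_le_pow_right (by norm_num) (by
      have := mem_range.1 hi; omega)
    rw [pow_add] at this
    omega
  change ∑ z : F, (∑ i ∈ range (5 + m), z ^ 2 ^ i) * z⁻¹ ^ b = _
  simp_rw [sum_mul]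
  rw [sum_comm, sum_congr rfl h, sum_range_add]
  have h0 : ∑ i ∈ range m, (if 2 ^ (5 + i) = b then (1 : F) else 0) = 0 := by
    refine sum_eq_zero fun i _ => if_neg ?_
    have : 1 ≤ 2 ^ i := Nat.one_le_two_pow
    rw [pow_add]
    omega
  rw [h0]
  interval_cases b <;> simp [sum_range_succ, -sum_boole]

theorem sum_inv_pow [CharP F 2] (c : F) (b : ℕ) :
    ∑ x : F, (x ^ 2 + x + c)⁻¹ ^ b = 0 := by
  have h := Equiv.sum_comp (Equiv.addRight (1 : F)) (fun x => x * (x ^ 2 + x + c)⁻¹ ^ b)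
  have h' : ∀ x : F, (x + 1) ^ 2 + (x + 1) + c = x ^ 2 + x + c := fun x => by
    linear_combination (x + 1) * (CharTwo.two_eq_zero : (2 : F) = 0)
  simpa [h', add_mul, sum_add_distrib] using h

theorem quadratic_ne_zero [CharP F 2] {n : ℕ} (hF : Fintype.card F = 2 ^ n) {c : F}
    (hc : absTrace F n c = 1) (x : F) : x ^ 2 + x + c ≠ 0 := by
  intro h
  have h1 : absTrace F n (artinSchreier F x + c) = 1 := by
    rw [map_add, hc, absTrace_artinSchreier hF, zero_add]
  rw [show artinSchreier F x + c = 0 from h, map_zero] at h1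
  exact zero_ne_one h1

/-- The mixed power sum of `x ^ a / (x ^ 2 + x + c) ^ b`. -/
def mixedSum (c : F) (a b : ℕ) : F := ∑ x : F, x ^ a * (x ^ 2 + x + c)⁻¹ ^ b

theorem mixedSum_add_two [CharP F 2] {n : ℕ} (hF : Fintype.card F = 2 ^ n) {c : F}
    (hc : absTrace F n c = 1) (a b : ℕ) :
    mixedSum c (a + 2) (b + 1) =
      mixedSum c a b + mixedSum c (a + 1) (b + 1) + c * mixedSum c a (b + 1) := by
  simp only [mixedSum, mul_sum, ← sum_add_distrib]
  refine sum_congr rfl fun x _ => ?_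
  have h := mul_inv_cancel₀ (quadratic_ne_zero hF hc x)
  generalize (x ^ 2 + x + c)⁻¹ = u at h
  linear_combination x ^ a * u ^ b * h -
    (x ^ a * u ^ b * (x + c) * u) * (CharTwo.two_eq_zero : (2 : F) = 0)

theorem sum_pow_eq_sum_mixedSum (c : F) (k : ℕ) :
    ∑ x : F, (x ^ 2 + (x ^ 2 + x + c)⁻¹) ^ k =
      ∑ b ∈ range (k + 1), (k.choose b : F) * mixedSum c (2 * (k - b)) b := by
  simp only [mixedSum, mul_sum]
  rw [sum_comm]
  refine sum_congr rfl fun x _ => ?_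
  rw [add_comm, add_pow]
  refine sum_congr rfl fun b _ => ?_
  rw [pow_mul]
  ring

end PowerSums

set_option maxHeartbeats 1000000 in
/-- For `q = 2^n`, `n ≥ 5`, `c ∈ F_q` with `Tr_{q/2}(c) = 1`, and
`f(x) = x² + 1/(x² + x + c)`, the power sums `∑_{x ∈ F_q} f(x)^k` vanish for
`1 ≤ k ≤ 10`, while `∑_{x ∈ F_q} f(x)¹¹ = 1`. -/
theorem stmt_15 (n : ℕ) (hn : 5 ≤ n) (q : ℕ) (hq : q = 2 ^ n)
    (F : Type*) [Field F] [Fintype F] (hF : Fintype.card F = q)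
    (c : F) (hc : ∑ i ∈ Finset.range n, c ^ 2 ^ i = 1) :
    (∀ k : ℕ, 1 ≤ k → k ≤ 10 →
        ∑ x : F, (x ^ 2 + (x ^ 2 + x + c)⁻¹) ^ k = 0) ∧
      ∑ x : F, (x ^ 2 + (x ^ 2 + x + c)⁻¹) ^ 11 = 1 := by
  subst hq
  have := charP_two_of_card hF
  replace hc : absTrace F n c = 1 := hc
  have hpoly : ∀ a, a < 31 → mixedSum c a 0 = 0 := by
    intro a ha
    have : 2 ^ 5 ≤ 2 ^ n := Nat.pow_le_pow_right (by norm_num) hn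
    simpa [mixedSum] using FiniteField.sum_pow_lt_card_sub_one F a (by omega)
  have hzero : ∀ b, mixedSum c 0 b = 0 := fun b => by
    simpa [mixedSum] using sum_inv_pow c b
  have hone : ∀ b, 0 < b → b < 16 →
      mixedSum c 1 b = if b = 1 ∨ b = 2 ∨ b = 4 ∨ b = 8 then 1 else 0 := fun b hb hb' => by
    simpa [mixedSum] using sum_mul_inv_pow hn hF hc hb hb'
  have hrec : ∀ a b, 2 ≤ a → 1 ≤ b → mixedSum c a b = mixedSum c (a - 2) (b - 1) +
      mixedSum c (a - 1) b + c * mixedSum c (a - 2) b := by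
    intro a b ha hb
    obtain ⟨a, rfl⟩ := Nat.exists_eq_add_of_le' ha
    obtain ⟨b, rfl⟩ := Nat.exists_eq_add_of_le' hb
    exact mixedSum_add_two hF hc a b
  constructor
  · intro k hk hk'
    rw [sum_pow_eq_sum_mixedSum]
    interval_cases k <;>
    · simp [sum_range_succ, Nat.choose]
      try reduce_mod_char!
      try simp [hpoly, hzero, hone, hrec]
      try reduce_mod_char!
      try ring_nf
      try reduce_mod_char!
  · rw [sum_pow_eq_sum_mixedSum]
    simp [sum_range_succ, Nat.choose]
    reduce_mod_char!
    simp [hpoly, hzero, hone, hrec]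
    ring_nf
    reduce_mod_char!
end

section
/- Let q = 3^n with n ≥ 3, let a ∈ F_q with a ≠ 0, and let r ∈ F_{q^2} with r ∉ F_q and r^2 ∈ F_q. Set b = −1/r^2 and define f: F_q → F_{q^2} by f(x) = a·x^2 + b·x + 1/(x − r) + 1/(x + r). Then the sum over all x ∈ F_q of f(x)^4 equals 0, while the sum over all x ∈ F_q of f(x)^5 equals −a/r^2; in particular the latter sum is nonzero. -/
open Polynomial in
/-- Carlitz's formula for a polynomial of degree less than `q`. -/
theorem FiniteField.sum_eval_algebraMap_of_natDegree_lt {F K : Type*} [Field F] [Fintype F]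
    [Field K] [Algebra F K] (p : K[X]) (hp : p.natDegree < Fintype.card F) :
    ∑ x : F, p.eval (algebraMap F K x) = -p.coeff (Fintype.card F - 1) := by
  classical
  have hq : 1 < Fintype.card F := Fintype.one_lt_card
  have top : ∑ x : F, x ^ (Fintype.card F - 1) = -1 := by
    have h : ∀ x : F, x ^ (Fintype.card F - 1) = 1 - if x = 0 then 1 else 0 := by
      intro x
      split_ifs with hx
      · rw [hx, zero_pow (by omega), sub_self]
      · rw [FiniteField.pow_card_sub_one_eq_one x hx, sub_zero]
    simp [h]
  simp_rw [eval_eq_sum_range' hp, ← map_pow]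
  rw [Finset.sum_comm]
  simp_rw [← Finset.mul_sum, ← map_sum]
  rw [Finset.sum_eq_single_of_mem (Fintype.card F - 1) (by simp; omega)]
  · simp [top]
  · intro i hi hne
    rw [FiniteField.sum_pow_lt_card_sub_one, map_zero, mul_zero]
    have := Finset.mem_range.1 hi
    omega

theorem FiniteField.sum_algebraMap_sub_pow_of_lt {F K : Type*} [Field F] [Fintype F]
    [Field K] [Algebra F K] (r : K) {k : ℕ} (hk : k < Fintype.card F - 1) :
    ∑ x : F, (algebraMap F K x - r) ^ k = 0 := by
  have hdeg : ((Polynomial.X - Polynomial.C r) ^ k).natDegree = k := by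
    simp
  have h := sum_eval_algebraMap_of_natDegree_lt (F := F)
    ((Polynomial.X - Polynomial.C r) ^ k) (by omega)
  rw [Polynomial.coeff_eq_zero_of_natDegree_lt (by omega)] at h
  simpa using h

theorem FiniteField.sum_algebraMap_sub_pow_card_sub_one {F K : Type*} [Field F] [Fintype F]
    [Field K] [Algebra F K] (r : K) :
    ∑ x : F, (algebraMap F K x - r) ^ (Fintype.card F - 1) = -1 := by
  have hdeg : ((Polynomial.X - Polynomial.C r) ^ (Fintype.card F - 1)).natDegree =
      Fintype.card F - 1 := by
    simp
  have hq : 1 < Fintype.card F := Fintype.one_lt_card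
  have h := sum_eval_algebraMap_of_natDegree_lt (F := F)
    ((Polynomial.X - Polynomial.C r) ^ (Fintype.card F - 1)) (by omega)
  have hmonic := ((Polynomial.monic_X_sub_C r).pow (Fintype.card F - 1)).coeff_natDegree
  rw [hdeg] at hmonic
  rw [hmonic] at h
  simpa using h

/-- An element outside `F` whose square lies in `F` is negated by the Frobenius of `F`. -/
theorem FiniteField.pow_card_eq_neg_of_sq_mem_range {F K : Type*} [Field F] [Fintype F]
    [Field K] [Algebra F K] (hF : ringChar F ≠ 2) {r : K}
    (hr : r ∉ Set.range (algebraMap F K)) (hr2 : r ^ 2 ∈ Set.range (algebraMap F K)) :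
    r ^ Fintype.card F = -r := by
  obtain ⟨c, hc⟩ := hr2
  have hc0 : c ≠ 0 := by
    rintro rfl
    rw [map_zero, eq_comm, sq_eq_zero_iff] at hc
    exact hr ⟨0, by rw [map_zero, hc]⟩
  have hpow : c ^ (Fintype.card F / 2) = -1 := by
    refine (FiniteField.pow_dichotomy hF hc0).resolve_left fun h => ?_
    obtain ⟨s, hs⟩ := (FiniteField.isSquare_iff hF hc0).2 h
    have : r ^ 2 = (algebraMap F K s) ^ 2 := by rw [← hc, hs, map_mul, sq]
    rcases sq_eq_sq_iff_eq_or_eq_neg.1 this with h | h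
    · exact hr ⟨s, h.symm⟩
    · exact hr ⟨-s, by rw [map_neg, h]⟩
  have hodd : Fintype.card F = 2 * (Fintype.card F / 2) + 1 := by
    have := FiniteField.odd_card_of_char_ne_two hF
    omega
  rw [hodd, pow_succ, pow_mul, ← hc, ← map_pow, hpow]
  simp

theorem algebraMap_sub_ne_zero_of_notMem_range {F K : Type*} [Field F] [Field K] [Algebra F K]
    {r : K} (hr : r ∉ Set.range (algebraMap F K)) (x : F) : algebraMap F K x - r ≠ 0 :=
  fun h => hr ⟨x, sub_eq_zero.1 h⟩

section PowerSums

variable {F K : Type*} [Field F] [Fintype F] [Field K] [Algebra F K] [CharP K 3] {r : K}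

theorem sum_inv_algebraMap_sub_pow_succ
    (hr : r ∉ Set.range (algebraMap F K)) (hfrob : r ^ Fintype.card F = -r)
    {j : ℕ} (hj : j + 1 < Fintype.card F) :
    ∑ x : F, (algebraMap F K x - r)⁻¹ ^ (j + 1) = r⁻¹ ^ (j + 1) := by
  have h3 : (3 : K) = 0 := CharP.cast_eq_zero K 3
  have hr0 : r ≠ 0 := fun h => hr ⟨0, by rw [map_zero, h]⟩
  have hcard : (Fintype.card F : K) = 0 := by
    rw [← map_natCast (algebraMap F K), FiniteField.cast_card_eq_zero, map_zero]
  have : CharP F 3 := RingHom.charP (algebraMap F K) (algebraMap F K).injective 3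
  obtain ⟨m, -, hm⟩ := FiniteField.card F 3
  have step (x : F) : (algebraMap F K x - r) ^ (Fintype.card F - 1) =
      1 - r * (algebraMap F K x - r)⁻¹ := by
    have hy := algebraMap_sub_ne_zero_of_notMem_range hr x
    have hpow : (algebraMap F K x - r) ^ Fintype.card F = algebraMap F K x + r := by
      have h := sub_pow_char_pow (algebraMap F K x) r (p := 3) (n := (m : ℕ))
      rwa [← hm, hfrob, ← map_pow, FiniteField.pow_card, sub_neg_eq_add] at h
    rw [(eq_mul_inv_iff_mul_eq₀ hy).2 (pow_sub_one_mul Fintype.card_ne_zero _), hpow]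
    field_simp
    linear_combination r * h3
  induction j with
  | zero =>
    have h := FiniteField.sum_algebraMap_sub_pow_card_sub_one (F := F) r
    simp_rw [step, Finset.sum_sub_distrib, ← Finset.mul_sum] at h
    simp only [Finset.sum_const, Finset.card_univ, nsmul_eq_mul, hcard, zero_mul, zero_sub,
      neg_inj] at h
    simpa using eq_inv_of_mul_eq_one_right h
  | succ j ih =>
    have h := FiniteField.sum_algebraMap_sub_pow_of_lt (F := F) r
      (k := Fintype.card F - 1 - (j + 1)) (by omega)
    have step' (x : F) : (algebraMap F K x - r) ^ (Fintype.card F - 1 - (j + 1)) =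
        (algebraMap F K x - r)⁻¹ ^ (j + 1) - r * (algebraMap F K x - r)⁻¹ ^ (j + 1 + 1) := by
      have hy := algebraMap_sub_ne_zero_of_notMem_range hr x
      rw [pow_sub₀ _ hy (by omega), step, ← inv_pow]
      ring
    simp_rw [step', Finset.sum_sub_distrib, ← Finset.mul_sum] at h
    rw [ih (by omega)] at h
    rw [pow_succ r⁻¹, sub_eq_zero.1 h]
    field_simp

/-- The power sums of `1 / (x ^ 2 - r ^ 2)` of exponents one to four. -/
theorem sum_inv_sq_sub_sq_pow
    (hr : r ∉ Set.range (algebraMap F K)) (hfrob : r ^ Fintype.card F = -r)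
    (hcard : 4 < Fintype.card F) :
    ∑ x : F, (algebraMap F K x ^ 2 - r ^ 2)⁻¹ = (r ^ 2)⁻¹ ∧
    ∑ x : F, (algebraMap F K x ^ 2 - r ^ 2)⁻¹ ^ 2 = 0 ∧
    ∑ x : F, (algebraMap F K x ^ 2 - r ^ 2)⁻¹ ^ 3 = (r ^ 2)⁻¹ ^ 3 ∧
    ∑ x : F, (algebraMap F K x ^ 2 - r ^ 2)⁻¹ ^ 4 = (r ^ 2)⁻¹ ^ 4 := by
  have h3 : (3 : K) = 0 := CharP.cast_eq_zero K 3
  have hr0 : r ≠ 0 := fun h => hr ⟨0, by rw [map_zero, h]⟩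
  have hr' : -r ∉ Set.range (algebraMap F K) :=
    fun ⟨y, hy⟩ => hr ⟨-y, by rw [map_neg, hy, neg_neg]⟩
  have hodd : Odd (Fintype.card F) := by
    have : CharP F 3 := RingHom.charP (algebraMap F K) (algebraMap F K).injective 3
    obtain ⟨m, -, hm⟩ := FiniteField.card F 3
    exact hm ▸ Odd.pow (by decide)
  have hfrob' : (-r) ^ Fintype.card F = -(-r) := by rw [hodd.neg_pow, hfrob]
  have hS (j : ℕ) (hj : j + 1 < Fintype.card F) := sum_inv_algebraMap_sub_pow_succ hr hfrob hj
  have hS' (j : ℕ) (hj : j + 1 < Fintype.card F) := sum_inv_algebraMap_sub_pow_succ hr' hfrob' hj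
  have prod (x : F) : (algebraMap F K x ^ 2 - r ^ 2)⁻¹ =
      (algebraMap F K x - -r)⁻¹ * (algebraMap F K x - r)⁻¹ := by
    rw [← mul_inv]
    congr 1
    ring
  have one (x : F) : r * (algebraMap F K x ^ 2 - r ^ 2)⁻¹ =
      (algebraMap F K x - -r)⁻¹ - (algebraMap F K x - r)⁻¹ := by
    have hs := algebraMap_sub_ne_zero_of_notMem_range hr x
    have ht := algebraMap_sub_ne_zero_of_notMem_range hr' x
    rw [prod, inv_sub_inv ht hs, ← mul_inv, ← div_eq_mul_inv]
    congr 1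
    linear_combination r * h3
  have two (x : F) : r ^ 2 * (algebraMap F K x ^ 2 - r ^ 2)⁻¹ ^ 2 =
      (algebraMap F K x - -r)⁻¹ ^ (1 + 1) + (algebraMap F K x - r)⁻¹ ^ (1 + 1) +
        (algebraMap F K x ^ 2 - r ^ 2)⁻¹ := by
    rw [← mul_pow, one, prod]
    linear_combination -(algebraMap F K x - -r)⁻¹ * (algebraMap F K x - r)⁻¹ * h3
  have four (x : F) : r ^ 4 * (algebraMap F K x ^ 2 - r ^ 2)⁻¹ ^ 4 =
      (algebraMap F K x - -r)⁻¹ ^ (3 + 1) + (algebraMap F K x - r)⁻¹ ^ (3 + 1) +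
        (algebraMap F K x ^ 2 - r ^ 2)⁻¹ ^ 2 -
        r ^ 2 * (algebraMap F K x ^ 2 - r ^ 2)⁻¹ ^ 3 := by
    have h2 := two x
    have hU := prod x
    rw [← mul_pow, one]
    generalize (algebraMap F K x ^ 2 - r ^ 2)⁻¹ = U at *
    generalize (algebraMap F K x - -r)⁻¹ = t at *
    generalize (algebraMap F K x - r)⁻¹ = s at *
    linear_combination U * h2 - (-4 * (t ^ 2 + s ^ 2) + 6 * (U + t * s)) * hU +
      (2 * U ^ 2 - U * (t ^ 2 + s ^ 2)) * h3
  have hv : r * r⁻¹ = 1 := mul_inv_cancel₀ hr0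
  have T1 : ∑ x : F, (algebraMap F K x ^ 2 - r ^ 2)⁻¹ = (r ^ 2)⁻¹ := by
    have h := Finset.sum_congr (rfl : (Finset.univ : Finset F) = _) fun x _ => one x
    have h0 := hS 0 (by omega)
    have h0' := hS' 0 (by omega)
    simp only [zero_add, pow_one, inv_neg] at h0 h0'
    rw [← Finset.mul_sum, Finset.sum_sub_distrib, h0, h0'] at h
    rw [← inv_pow]
    linear_combination r⁻¹ * h - (∑ x : F, (algebraMap F K x ^ 2 - r ^ 2)⁻¹) * hv - r⁻¹ ^ 2 * h3
  have T2 : ∑ x : F, (algebraMap F K x ^ 2 - r ^ 2)⁻¹ ^ 2 = 0 := by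
    have h := Finset.sum_congr (rfl : (Finset.univ : Finset F) = _) fun x _ => two x
    rw [← Finset.mul_sum, Finset.sum_add_distrib, Finset.sum_add_distrib, hS 1 (by omega),
      hS' 1 (by omega), T1, inv_neg, ← inv_pow] at h
    refine (mul_eq_zero_iff_left (pow_ne_zero 2 hr0)).1 (h.trans ?_)
    linear_combination r⁻¹ ^ 2 * h3
  have T3 : ∑ x : F, (algebraMap F K x ^ 2 - r ^ 2)⁻¹ ^ 3 = (r ^ 2)⁻¹ ^ 3 := by
    rw [← sum_pow_char 3, T1]
  refine ⟨T1, T2, T3, mul_left_cancel₀ (pow_ne_zero 4 hr0) ?_⟩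
  have h := Finset.sum_congr (rfl : (Finset.univ : Finset F) = _) fun x _ => four x
  rw [← Finset.mul_sum, Finset.sum_sub_distrib, Finset.sum_add_distrib, Finset.sum_add_distrib,
    ← Finset.mul_sum, hS 3 (by omega), hS' 3 (by omega), T2, T3, inv_neg] at h
  rw [h, ← inv_pow]
  linear_combination
    -(r⁻¹ ^ 4 * ((r * r⁻¹ + 1) + (1 + r * r⁻¹) * (1 + (r * r⁻¹) ^ 2))) * hv

end PowerSums

theorem FiniteField.sum_algebraMap_pow_of_lt {F K : Type*} [Field F] [Fintype F] [Field K]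
    [Algebra F K] {k : ℕ} (hk : k < Fintype.card F - 1) :
    ∑ x : F, algebraMap F K x ^ k = 0 := by
  simpa using FiniteField.sum_algebraMap_sub_pow_of_lt (F := F) (0 : K) hk


/-- For `q = 3^n`, `n ≥ 3`, `a ∈ F_q*`, `r ∈ F_{q²} \ F_q` with `r² ∈ F_q`, `b = -1/r²`,
and `f(x) = a·x² + b·x + 1/(x - r) + 1/(x + r)`, `∑ f(x)⁴ = 0` while
`∑ f(x)⁵ = -a/r² ≠ 0`. -/
theorem stmt_16 (n : ℕ) (hn : 3 ≤ n) (q : ℕ) (hq : q = 3 ^ n)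
    (F K : Type*) [Field F] [Fintype F] [Field K] [Fintype K] [Algebra F K]
    (hF : Fintype.card F = q) (hK : Fintype.card K = q ^ 2)
    (a : F) (ha : a ≠ 0)
    (r : K) (hr : r ∉ Set.range (algebraMap F K))
    (hr2 : r ^ 2 ∈ Set.range (algebraMap F K)) :
    (∑ x : F, (algebraMap F K (a * x ^ 2) + (-(r ^ 2)⁻¹) * algebraMap F K x
        + (algebraMap F K x - r)⁻¹ + (algebraMap F K x + r)⁻¹) ^ 4 = 0) ∧
    (∑ x : F, (algebraMap F K (a * x ^ 2) + (-(r ^ 2)⁻¹) * algebraMap F K x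
        + (algebraMap F K x - r)⁻¹ + (algebraMap F K x + r)⁻¹) ^ 5
      = -(algebraMap F K a) / r ^ 2) ∧
    -(algebraMap F K a) / r ^ 2 ≠ 0 := by
  have : CharP F 3 := charP_of_card_eq_prime_pow (hF.trans hq)
  have : CharP K 3 := charP_of_injective_algebraMap (algebraMap F K).injective 3
  have h3 : (3 : K) = 0 := CharP.cast_eq_zero K 3
  have hr0 : r ≠ 0 := fun h => hr ⟨0, by rw [map_zero, h]⟩
  have hcard : 27 ≤ Fintype.card F := by
    rw [hF, hq]
    exact Nat.pow_le_pow_right (n := 3) (by norm_num) hn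
  have hfrob : r ^ Fintype.card F = -r :=
    FiniteField.pow_card_eq_neg_of_sq_mem_range (by rw [ringChar.eq F 3]; norm_num) hr hr2
  obtain ⟨T1, T2, T3, T4⟩ := sum_inv_sq_sub_sq_pow hr hfrob (by omega)
  have hr' : -r ∉ Set.range (algebraMap F K) :=
    fun ⟨y, hy⟩ => hr ⟨-y, by rw [map_neg, hy, neg_neg]⟩
  have hf (x : F) : algebraMap F K (a * x ^ 2) + (-(r ^ 2)⁻¹) * algebraMap F K x
        + (algebraMap F K x - r)⁻¹ + (algebraMap F K x + r)⁻¹ =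
      algebraMap F K a * algebraMap F K x ^ 2 -
        (r ^ 2)⁻¹ * algebraMap F K x ^ 3 * (algebraMap F K x ^ 2 - r ^ 2)⁻¹ := by
    have hs := algebraMap_sub_ne_zero_of_notMem_range hr x
    have ht := algebraMap_sub_ne_zero_of_notMem_range hr' x
    rw [sub_neg_eq_add] at ht
    have hu : algebraMap F K x ^ 2 - r ^ 2 =
        (algebraMap F K x + r) * (algebraMap F K x - r) := by ring
    rw [hu, map_mul, map_pow]
    field_simp
    linear_combination algebraMap F K x * r ^ 2 * h3
  simp_rw [hf]
  -- The terms of odd degree cancel under `x ↦ -x`.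
  have even (g : F → K) : ∑ x : F, g x = -∑ x : F, (g x + g (-x)) := by
    have h : ∑ x : F, g (-x) = ∑ x : F, g x := Equiv.sum_comp (Equiv.neg F) g
    rw [Finset.sum_add_distrib, h]
    linear_combination (∑ x : F, g x) * h3
  have hu0 (x : F) : algebraMap F K x ^ 2 - r ^ 2 ≠ 0 := by
    have hs := algebraMap_sub_ne_zero_of_notMem_range hr x
    have ht := algebraMap_sub_ne_zero_of_notMem_range hr' x
    have hu : algebraMap F K x ^ 2 - r ^ 2 =
        (algebraMap F K x - -r) * (algebraMap F K x - r) := by ring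
    exact hu ▸ mul_ne_zero ht hs
  have P {k : ℕ} (hk : k < 26) : ∑ x : F, algebraMap F K x ^ k = 0 :=
    FiniteField.sum_algebraMap_pow_of_lt (by omega)
  have hd : r ^ 2 ≠ 0 := pow_ne_zero 2 hr0
  set d := r ^ 2
  set A := algebraMap F K a
  have hred₁ (x : F) : algebraMap F K x ^ 12 * (algebraMap F K x ^ 2 - d)⁻¹ ^ 2 =
      algebraMap F K x ^ 8 - d * algebraMap F K x ^ 6 + d ^ 3 * algebraMap F K x ^ 2
        - d ^ 4 * algebraMap F K x ^ 0 + d ^ 6 * (algebraMap F K x ^ 2 - d)⁻¹ ^ 2 := by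
    have hw := hu0 x
    generalize hwX : algebraMap F K x ^ 2 - d = w at hw ⊢
    have h2 : algebraMap F K x ^ 2 = w + d := by rw [← hwX]; ring
    rw [show algebraMap F K x ^ 12 = (algebraMap F K x ^ 2) ^ 6 by ring,
      show algebraMap F K x ^ 8 = (algebraMap F K x ^ 2) ^ 4 by ring,
      show algebraMap F K x ^ 6 = (algebraMap F K x ^ 2) ^ 3 by ring, h2, pow_zero]
    field_simp
    linear_combination (w ^ 5 * d + 4 * w ^ 4 * d ^ 2 + 6 * w ^ 3 * d ^ 3 + 5 * w ^ 2 * d ^ 4 +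
      2 * w * d ^ 5) * h3
  have hred₂ (x : F) : algebraMap F K x ^ 12 * (algebraMap F K x ^ 2 - d)⁻¹ ^ 4 =
      algebraMap F K x ^ 4 + d * algebraMap F K x ^ 2 + d ^ 2 * algebraMap F K x ^ 0
        + 2 * d ^ 3 * (algebraMap F K x ^ 2 - d)⁻¹
        + d ^ 6 * (algebraMap F K x ^ 2 - d)⁻¹ ^ 4 := by
    have hw := hu0 x
    generalize hwX : algebraMap F K x ^ 2 - d = w at hw ⊢
    have h2 : algebraMap F K x ^ 2 = w + d := by rw [← hwX]; ring
    rw [show algebraMap F K x ^ 12 = (algebraMap F K x ^ 2) ^ 6 by ring,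
      show algebraMap F K x ^ 4 = (algebraMap F K x ^ 2) ^ 2 by ring, h2, pow_zero]
    field_simp
    linear_combination (w ^ 5 * d + 4 * w ^ 4 * d ^ 2 + 6 * w ^ 3 * d ^ 3 + 5 * w ^ 2 * d ^ 4 +
      2 * w * d ^ 5) * h3
  have hred₃ (x : F) : algebraMap F K x ^ 14 * (algebraMap F K x ^ 2 - d)⁻¹ ^ 4 =
      algebraMap F K x ^ 6 + d * algebraMap F K x ^ 4 + d ^ 2 * algebraMap F K x ^ 2
        + 2 * d ^ 3 * algebraMap F K x ^ 0 + 2 * d ^ 4 * (algebraMap F K x ^ 2 - d)⁻¹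
        + d ^ 6 * (algebraMap F K x ^ 2 - d)⁻¹ ^ 3
        + d ^ 7 * (algebraMap F K x ^ 2 - d)⁻¹ ^ 4 := by
    have h := hred₂ x
    have hw := mul_inv_cancel₀ (hu0 x)
    linear_combination algebraMap F K x ^ 2 * h +
      (2 * d ^ 3 + d ^ 6 * (algebraMap F K x ^ 2 - d)⁻¹ ^ 3) * hw
  have hsum₁ : ∑ x : F, algebraMap F K x ^ 12 * (algebraMap F K x ^ 2 - d)⁻¹ ^ 2 = 0 := by
    simp_rw [hred₁, Finset.sum_add_distrib, Finset.sum_sub_distrib, Finset.sum_add_distrib,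
      Finset.sum_sub_distrib, ← Finset.mul_sum]
    rw [P (by norm_num), P (by norm_num), P (by norm_num), P (by norm_num), T2]
    ring
  have hsum₂ : ∑ x : F, algebraMap F K x ^ 12 * (algebraMap F K x ^ 2 - d)⁻¹ ^ 4 = 0 := by
    simp_rw [hred₂, Finset.sum_add_distrib, ← Finset.mul_sum]
    rw [P (by norm_num), P (by norm_num), P (by norm_num), T1, T4]
    field_simp
    linear_combination d ^ 2 * h3
  have hsum₃ : ∑ x : F, algebraMap F K x ^ 14 * (algebraMap F K x ^ 2 - d)⁻¹ ^ 4 = d ^ 3 := by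
    simp_rw [hred₃, Finset.sum_add_distrib, ← Finset.mul_sum]
    rw [P (by norm_num), P (by norm_num), P (by norm_num), P (by norm_num), T1, T3, T4]
    field_simp
    linear_combination d ^ 3 * h3
  refine ⟨?_, ?_, div_ne_zero (neg_ne_zero.2 (by simpa [A] using ha)) hd⟩
  · rw [even]
    have hpair (x : F) :
        (A * algebraMap F K x ^ 2 -
          d⁻¹ * algebraMap F K x ^ 3 * (algebraMap F K x ^ 2 - d)⁻¹) ^ 4 +
        (A * algebraMap F K (-x) ^ 2 -
          d⁻¹ * algebraMap F K (-x) ^ 3 * (algebraMap F K (-x) ^ 2 - d)⁻¹) ^ 4 =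
        2 * A ^ 4 * algebraMap F K x ^ 8 +
          2 * d⁻¹ ^ 4 * (algebraMap F K x ^ 12 * (algebraMap F K x ^ 2 - d)⁻¹ ^ 4) := by
      rw [map_neg, neg_sq]
      generalize (algebraMap F K x ^ 2 - d)⁻¹ = U
      linear_combination 4 * A ^ 2 * algebraMap F K x ^ 10 * d⁻¹ ^ 2 * U ^ 2 * h3
    simp_rw [hpair, Finset.sum_add_distrib, ← Finset.mul_sum]
    rw [P (by norm_num), hsum₂]
    ring
  · rw [even]
    have hpair (x : F) :
        (A * algebraMap F K x ^ 2 -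
          d⁻¹ * algebraMap F K x ^ 3 * (algebraMap F K x ^ 2 - d)⁻¹) ^ 5 +
        (A * algebraMap F K (-x) ^ 2 -
          d⁻¹ * algebraMap F K (-x) ^ 3 * (algebraMap F K (-x) ^ 2 - d)⁻¹) ^ 5 =
        2 * A ^ 5 * algebraMap F K x ^ 10 +
          20 * A ^ 3 * d⁻¹ ^ 2 * (algebraMap F K x ^ 12 * (algebraMap F K x ^ 2 - d)⁻¹ ^ 2) +
          10 * A * d⁻¹ ^ 4 * (algebraMap F K x ^ 14 * (algebraMap F K x ^ 2 - d)⁻¹ ^ 4) := by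
      rw [map_neg, neg_sq]
      ring
    simp_rw [hpair, Finset.sum_add_distrib, ← Finset.mul_sum]
    rw [P (by norm_num), hsum₁, hsum₃]
    field_simp
    linear_combination -3 * A * d * h3
end

section
/- Let q = 3^n with n ≥ 3, let a ∈ F_q with a ≠ 0, and let r ∈ F_{q^3} with r ∉ F_q. Write r_1 = r, r_2 = r^q, r_3 = r^{q^2}, and define f: F_q → F_{q^3} by f(x) = a·x + 1/(x − r_1) + 1/(x − r_2) + 1/(x − r_3). Then the sum over all x ∈ F_q of f(x) equals (r_1 + r_2 + r_3)^2 / ((r_1 − r_2)(r_2 − r_3)(r_3 − r_1)). -/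
open Polynomial in
theorem FiniteField.prod_X_sub_C_eq_X_pow_card_sub_X (F : Type*) [Field F] [Fintype F] :
    ∏ x : F, (X - C x) = (X ^ Fintype.card F - X : F[X]) := by
  have hmonic : (X ^ Fintype.card F - X : F[X]).Monic :=
    monic_X_pow_sub (by simpa using Fintype.one_lt_card (α := F))
  have hroots := FiniteField.roots_X_pow_card_sub_X F
  have h := prod_multiset_X_sub_C_of_monic_of_roots_card_eq hmonic (by
    rw [hroots, FiniteField.X_pow_card_sub_X_natDegree_eq F Fintype.one_lt_card]
    rfl)
  rwa [hroots] at h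

open Polynomial in
theorem FiniteField.prod_sub_algebraMap {F K : Type*} [Field F] [Fintype F] [Field K]
    [Algebra F K] (y : K) :
    ∏ x : F, (y - algebraMap F K x) = y ^ Fintype.card F - y := by
  simpa [map_prod] using
    congrArg (aeval y) (FiniteField.prod_X_sub_C_eq_X_pow_card_sub_X F)

theorem FiniteField.pow_card_sub_self_ne_zero {F K : Type*} [Field F] [Fintype F] [Field K]
    [Algebra F K] {y : K} (hy : y ∉ Set.range (algebraMap F K)) :
    y ^ Fintype.card F - y ≠ 0 := by
  rw [← FiniteField.prod_sub_algebraMap (F := F), Finset.prod_ne_zero_iff]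
  exact fun x _ h => hy ⟨x, (sub_eq_zero.mp h).symm⟩

open Polynomial in
/-- Logarithmic derivative of `X ^ q - X = ∏ x : F, (X - x)`, evaluated outside `F`. -/
theorem FiniteField.sum_inv_algebraMap_sub {F K : Type*} [Field F] [Fintype F] [Field K]
    [Algebra F K] {y : K} (hy : y ∉ Set.range (algebraMap F K)) :
    ∑ x : F, (algebraMap F K x - y)⁻¹ = (y ^ Fintype.card F - y)⁻¹ := by
  classical
  have hder : ∑ x : F, ∏ z ∈ Finset.univ.erase x, (y - algebraMap F K z) = -1 := by
    simpa [derivative_prod_finset, derivative_X_pow, map_sum, map_prod] using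
      congrArg (fun p : F[X] => aeval y (derivative p))
        (FiniteField.prod_X_sub_C_eq_X_pow_card_sub_X F)
  have hterm : ∀ x : F, (algebraMap F K x - y)⁻¹ * (y ^ Fintype.card F - y)
      = -∏ z ∈ Finset.univ.erase x, (y - algebraMap F K z) := by
    intro x
    have hx : y - algebraMap F K x ≠ 0 := fun h => hy ⟨x, (sub_eq_zero.mp h).symm⟩
    rw [← FiniteField.prod_sub_algebraMap, ← Finset.mul_prod_erase _ _ (Finset.mem_univ x),
      ← neg_sub y, inv_neg, neg_mul, inv_mul_cancel_left₀ hx]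
  refine eq_inv_of_mul_eq_one_left ?_
  rw [Finset.sum_mul, Finset.sum_congr rfl fun x _ => hterm x, Finset.sum_neg_distrib, hder,
    neg_neg]



/-- For `q = 3^n`, `n ≥ 3`, `a ∈ F_q*`, `r ∈ F_{q³} \ F_q`, with `r₁ = r`, `r₂ = r^q`,
`r₃ = r^{q²}`, and `f(x) = a·x + 1/(x - r₁) + 1/(x - r₂) + 1/(x - r₃)`,
`∑_{x ∈ F_q} f(x) = (r₁ + r₂ + r₃)² / ((r₁ - r₂)(r₂ - r₃)(r₃ - r₁))`. -/
theorem stmt_17 (n : ℕ) (hn : 3 ≤ n) (q : ℕ) (hq : q = 3 ^ n)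
    (F K : Type*) [Field F] [Fintype F] [Field K] [Fintype K] [Algebra F K]
    (hF : Fintype.card F = q) (hK : Fintype.card K = q ^ 3)
    (a : F) (ha : a ≠ 0)
    (r : K) (hr : r ∉ Set.range (algebraMap F K)) :
    ∑ x : F, (algebraMap F K (a * x) + (algebraMap F K x - r)⁻¹
        + (algebraMap F K x - r ^ q)⁻¹ + (algebraMap F K x - r ^ q ^ 2)⁻¹)
      = (r + r ^ q + r ^ q ^ 2) ^ 2
        / ((r - r ^ q) * (r ^ q - r ^ q ^ 2) * (r ^ q ^ 2 - r)) := by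
  subst hF
  have h3 : (3 : K) = 0 := by
    have h : ((Fintype.card K : ℕ) : K) = 0 := Nat.cast_card_eq_zero K
    rw [hK, hq] at h
    push_cast at h
    exact eq_zero_of_pow_eq_zero (eq_zero_of_pow_eq_zero h)
  set q := Fintype.card F with hqF
  have hfix : ∀ x : F, algebraMap F K x ^ q = algebraMap F K x := fun x => by
    rw [← map_pow, FiniteField.pow_card]
  have hr3 : (r ^ q ^ 2) ^ q = r := by
    rw [← pow_mul, ← pow_succ, ← hK, FiniteField.pow_card]
  have hr2 : (r ^ q) ^ q = r ^ q ^ 2 := by rw [← pow_mul, sq]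
  have hmem3 : r ^ q ^ 2 ∉ Set.range (algebraMap F K) := by
    rintro ⟨x, hx⟩
    exact hr ⟨x, by rw [← hr3, ← hx, hfix]⟩
  have hmem2 : r ^ q ∉ Set.range (algebraMap F K) := by
    rintro ⟨x, hx⟩
    exact hmem3 ⟨x, by rw [← hr2, ← hx, hfix]⟩
  have hlin : ∑ x : F, algebraMap F K (a * x) = 0 := by
    have hcard : 1 < Fintype.card F - 1 := by
      have : 3 ^ 3 ≤ 3 ^ n := Nat.pow_le_pow_right (by norm_num) hn
      omega
    have h := FiniteField.sum_pow_lt_card_sub_one F 1 hcard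
    simp only [pow_one] at h
    rw [← map_sum, ← Finset.mul_sum, h, mul_zero, map_zero]
  simp only [Finset.sum_add_distrib]
  rw [hlin, FiniteField.sum_inv_algebraMap_sub hr, FiniteField.sum_inv_algebraMap_sub hmem2,
    FiniteField.sum_inv_algebraMap_sub hmem3, ← hqF, hr2, hr3]
  have h12 := FiniteField.pow_card_sub_self_ne_zero hr
  have h23 := FiniteField.pow_card_sub_self_ne_zero hmem2
  have h31 := FiniteField.pow_card_sub_self_ne_zero hmem3
  rw [← hqF] at h12 h23 h31
  rw [hr2] at h23
  rw [hr3] at h31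
  generalize r ^ q ^ 2 = t at *
  generalize r ^ q = s at *
  have h12' : r - s ≠ 0 := by rwa [← neg_sub, neg_ne_zero]
  have h23' : s - t ≠ 0 := by rwa [← neg_sub, neg_ne_zero]
  have h31' : t - r ≠ 0 := by rwa [← neg_sub, neg_ne_zero]
  rw [← neg_sub r s, ← neg_sub s t, ← neg_sub t r, inv_neg, inv_neg, inv_neg]
  field_simp
  linear_combination (-(r * s + s * t + t * r)) * h3
end
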